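/- With v_a = −2cpq/(a·D) + 1, v_{−a} = 2cpq/(a·D) + 1, D = pq+2c(mp+nq), P² = a²−p², Q² = a²−q², and ϱ(n,m) = (P/(a−p))ⁿ(Q/(a−q))ᵐ, the function u = (A+(−1)^{n+m}B)ϱ·v_a + ((−1)^{n+m}C+D₀)ϱ⁻¹·v_{−a}, with constants satisfying A·D₀ − B·C = δ/(4a), satisfies the re-parameterized H3_δ equation P(a²−q²)(u·ũ + û·û̃) − Q(a²−p²)(u·û + ũ·û̃) = δ(p²−q²) wherever D and its shifts are nonzero. -/

import Mathlib

lemma rational_seed_homogeneous {p q c a x x₁ x₂ x₁₂ : ℝ} (ha : a ≠ 0)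
    (hx : x ≠ 0) (hx₁ : x₁ ≠ 0) (hx₂ : x₂ ≠ 0) (hx₁₂ : x₁₂ ≠ 0)
    (h₁ : x₁ = x + 2*c*q) (h₂ : x₂ = x + 2*c*p) (h₁₂ : x₁₂ = x + 2*c*p + 2*c*q) :
    (a+p) * ((a^2-q^2) * ((-(2*c*p*q) / (a*x) + 1) * (-(2*c*p*q) / (a*x₁) + 1))
        + (a+q)^2 * ((-(2*c*p*q) / (a*x₂) + 1) * (-(2*c*p*q) / (a*x₁₂) + 1)))
      = (a+q) * ((a^2-p^2) * ((-(2*c*p*q) / (a*x) + 1) * (-(2*c*p*q) / (a*x₂) + 1))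
        + (a+p)^2 * ((-(2*c*p*q) / (a*x₁) + 1) * (-(2*c*p*q) / (a*x₁₂) + 1))) := by
  field_simp
  subst h₁ h₂ h₁₂
  ring

lemma rational_seed_mixed {p q c a x x₁ x₂ x₁₂ : ℝ} (ha : a ≠ 0)
    (hx : x ≠ 0) (hx₁ : x₁ ≠ 0) (hx₂ : x₂ ≠ 0) (hx₁₂ : x₁₂ ≠ 0)
    (h₁ : x₁ = x + 2*c*q) (h₂ : x₂ = x + 2*c*p) (h₁₂ : x₁₂ = x + 2*c*p + 2*c*q) :
    (a^2-q^2) * ((a-p) * ((-(2*c*p*q) / (a*x) + 1) * (2*c*p*q / (a*x₁) + 1))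
        + (a+p) * ((-(2*c*p*q) / (a*x₁₂) + 1) * (2*c*p*q / (a*x₂) + 1)))
      - (a^2-p^2) * ((a-q) * ((-(2*c*p*q) / (a*x) + 1) * (2*c*p*q / (a*x₂) + 1))
        + (a+q) * ((-(2*c*p*q) / (a*x₁₂) + 1) * (2*c*p*q / (a*x₁) + 1)))
      = 2*a*(p^2-q^2) := by
  field_simp
  subst h₁ h₂ h₁₂
  ring

lemma neg_div_neg_mul (k a x : ℝ) :
    -k / (-a * x) = k / (a * x) ∧ k / (-a * x) = -k / (a * x) := by
  rw [neg_mul, neg_div_neg_eq, div_neg, neg_div]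
  exact ⟨rfl, rfl⟩

lemma sqrt_div_sub_relations {a p P : ℝ} (h : a^2 > p^2) (hP : P = Real.sqrt (a^2 - p^2))
    (hap : a - p ≠ 0) :
    P/(a-p) ≠ 0 ∧ P * (P/(a-p)) = a+p ∧ P * (P/(a-p))⁻¹ = a-p
      ∧ (a^2-p^2) * (P/(a-p))^2 = (a+p)^2
      ∧ (a^2-p^2) * ((P/(a-p))⁻¹)^2 = (a-p)^2 := by
  have hpos : 0 < a^2 - p^2 := sub_pos.mpr h
  have hP0 : P ≠ 0 := hP ▸ (Real.sqrt_pos.mpr hpos).ne'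
  have hP2 : P^2 = a^2 - p^2 := hP ▸ Real.sq_sqrt hpos.le
  refine ⟨div_ne_zero hP0 hap, ?_, ?_, ?_, ?_⟩
  · field_simp
    linear_combination hP2
  · field_simp
  · field_simp
    linear_combination (a^2 - p^2) * hP2
  · field_simp
    linear_combination -hP2

/-- The quadrilateral equation for four values that are sums of two plane waves
with mutually inverse multipliers, given the bilinear relations between their
rational factors. -/
lemma quad_of_amplitudes {p q a P Q α α' β β' X X' Y Y' K : ℝ}
    {v v₁ v₂ v₁₂ w w₁ w₂ w₁₂ : ℝ} (hα : α * α' = 1) (hβ : β * β' = 1)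
    (hPα : P * α = a+p) (hPα' : P * α' = a-p) (hQβ : Q * β = a+q) (hQβ' : Q * β' = a-q)
    (hα2 : (a^2-p^2) * α^2 = (a+p)^2) (hα2' : (a^2-p^2) * α'^2 = (a-p)^2)
    (hβ2 : (a^2-q^2) * β^2 = (a+q)^2) (hβ2' : (a^2-q^2) * β'^2 = (a-q)^2)
    (hX : (a+p) * ((a^2-q^2) * (v * v₁) + (a+q)^2 * (v₂ * v₁₂))
      = (a+q) * ((a^2-p^2) * (v * v₂) + (a+p)^2 * (v₁ * v₁₂)))
    (hY : (a-p) * ((a^2-q^2) * (w * w₁) + (a-q)^2 * (w₂ * w₁₂))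
      = (a-q) * ((a^2-p^2) * (w * w₂) + (a-p)^2 * (w₁ * w₁₂)))
    (hXY' : (a^2-q^2) * ((a-p) * (v * w₁) + (a+p) * (v₁₂ * w₂))
      - (a^2-p^2) * ((a-q) * (v * w₂) + (a+q) * (v₁₂ * w₁)) = K)
    (hX'Y : (a^2-q^2) * ((a+p) * (v₁ * w) + (a-p) * (v₂ * w₁₂))
      - (a^2-p^2) * ((a+q) * (v₂ * w) + (a-q) * (v₁ * w₁₂)) = K) :
    P * (a^2 - q^2) * ((X*v + Y*w) * (X'*α*v₁ + Y'*α'*w₁)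
        + (X'*β*v₂ + Y'*β'*w₂) * (X*α*β*v₁₂ + Y*α'*β'*w₁₂))
      - Q * (a^2 - p^2) * ((X*v + Y*w) * (X'*β*v₂ + Y'*β'*w₂)
        + (X'*α*v₁ + Y'*α'*w₁) * (X*α*β*v₁₂ + Y*α'*β'*w₁₂))
      = K * (X*Y' + X'*Y) := by
  have hP : P * ((X*v + Y*w) * (X'*α*v₁ + Y'*α'*w₁)
        + (X'*β*v₂ + Y'*β'*w₂) * (X*α*β*v₁₂ + Y*α'*β'*w₁₂))
      = X*X' * (a+p) * (v*v₁ + β^2*(v₂*v₁₂)) + Y*Y' * (a-p) * (w*w₁ + β'^2*(w₂*w₁₂))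
        + X*Y' * ((a-p)*(v*w₁) + (a+p)*(v₁₂*w₂))
        + X'*Y * ((a+p)*(v₁*w) + (a-p)*(v₂*w₁₂)) := by
    rw [← hPα, ← hPα']
    linear_combination (X*Y'*P*α*v₁₂*w₂ + X'*Y*P*α'*v₂*w₁₂) * hβ
  have hQ : Q * ((X*v + Y*w) * (X'*β*v₂ + Y'*β'*w₂)
        + (X'*α*v₁ + Y'*α'*w₁) * (X*α*β*v₁₂ + Y*α'*β'*w₁₂))
      = X*X' * (a+q) * (v*v₂ + α^2*(v₁*v₁₂)) + Y*Y' * (a-q) * (w*w₂ + α'^2*(w₁*w₁₂))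
        + X*Y' * ((a-q)*(v*w₂) + (a+q)*(v₁₂*w₁))
        + X'*Y * ((a+q)*(v₂*w) + (a-q)*(v₁*w₁₂)) := by
    rw [← hQβ, ← hQβ']
    linear_combination (X*Y'*Q*β*v₁₂*w₁ + X'*Y*Q*β'*v₁*w₁₂) * hα
  linear_combination (a^2-q^2) * hP - (a^2-p^2) * hQ + X*X' * hX + Y*Y' * hY
    + X*Y' * hXY' + X'*Y * hX'Y
    + X*X'*(a+p)*(v₂*v₁₂) * hβ2 + Y*Y'*(a-p)*(w₂*w₁₂) * hβ2'
    - X*X'*(a+q)*(v₁*v₁₂) * hα2 - Y*Y'*(a-q)*(w₁*w₁₂) * hα2'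


/-- The N=2 rational solution of the re-parameterized H3_δ equation, obtained by
degeneration from Q3_δ:
`u = (A+(−1)^{n+m}B)ϱ·v_a + ((−1)^{n+m}C+D₀)ϱ⁻¹·v_{−a}` with `AD₀−BC = δ/(4a)`
satisfies `P(a²−q²)(u·ũ + û·û̃) − Q(a²−p²)(u·û + ũ·û̃) = δ(p²−q²)`. -/
theorem stmt_13 (p q c a P Q A B C D₀ δ : ℝ)
    (hp : p ≠ 0) (hq : q ≠ 0) (hc : c ≠ 0) (ha : a ≠ 0)
    (hap : a^2 > p^2) (haq : a^2 > q^2)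
    (hP : P = Real.sqrt (a^2 - p^2)) (hQ : Q = Real.sqrt (a^2 - q^2))
    (hap' : a - p ≠ 0) (haq' : a - q ≠ 0)
    (hABCD : A*D₀ - B*C = δ/(4*a))
    (D va vma ϱ u : ℤ → ℤ → ℝ)
    (hD : ∀ n m : ℤ, D n m = p*q + 2*c*((m : ℝ)*p + (n : ℝ)*q))
    (hva : ∀ n m : ℤ, va n m = -(2*c*p*q) / (a * D n m) + 1)
    (hvma : ∀ n m : ℤ, vma n m = 2*c*p*q / (a * D n m) + 1)
    (hϱ : ∀ n m : ℤ, ϱ n m = (P/(a-p))^n * (Q/(a-q))^m)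
    (hu : ∀ n m : ℤ, u n m = (A + (-1 : ℝ)^(n+m) * B) * ϱ n m * va n m
      + ((-1 : ℝ)^(n+m) * C + D₀) * (ϱ n m)⁻¹ * vma n m)
    (n m : ℤ)
    (h1 : D n m ≠ 0) (h2 : D (n+1) m ≠ 0) (h3 : D n (m+1) ≠ 0) (h4 : D (n+1) (m+1) ≠ 0) :
    P * (a^2 - q^2) * (u n m * u (n+1) m + u n (m+1) * u (n+1) (m+1))
      - Q * (a^2 - p^2) * (u n m * u n (m+1) + u (n+1) m * u (n+1) (m+1))
      = δ * (p^2 - q^2) := by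
  obtain ⟨hα, hPα, hPα', hα2, hα2'⟩ := sqrt_div_sub_relations hap hP hap'
  obtain ⟨hβ, hQβ, hQβ', hβ2, hβ2'⟩ := sqrt_div_sub_relations haq hQ haq'
  set α := P/(a-p)
  set β := Q/(a-q)
  have e₁ : D (n+1) m = D n m + 2*c*q := by
    rw [hD, hD]
    push_cast
    ring
  have e₂ : D n (m+1) = D n m + 2*c*p := by
    rw [hD, hD]
    push_cast
    ring
  have e₁₂ : D (n+1) (m+1) = D n m + 2*c*p + 2*c*q := by
    rw [hD, hD]
    push_cast
    ring
  have hX := rational_seed_homogeneous ha h1 h2 h3 h4 e₁ e₂ e₁₂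
  have hY := rational_seed_homogeneous (neg_ne_zero.mpr ha) h1 h2 h3 h4 e₁ e₂ e₁₂
  have hXY' := rational_seed_mixed ha h1 h2 h3 h4 e₁ e₂ e₁₂
  have hX'Y := rational_seed_mixed (neg_ne_zero.mpr ha) h1 h2 h3 h4 e₁ e₂ e₁₂
  simp only [(neg_div_neg_mul _ _ _).1, (neg_div_neg_mul _ _ _).2] at hY hX'Y
  simp only [← hva, ← hvma] at hX hY hXY' hX'Y
  have r₁ : ϱ (n+1) m = ϱ n m * α := by
    rw [hϱ, hϱ, zpow_add_one₀ hα]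
    ring
  have r₂ : ϱ n (m+1) = ϱ n m * β := by
    rw [hϱ, hϱ, zpow_add_one₀ hβ]
    ring
  have r₁₂ : ϱ (n+1) (m+1) = ϱ n m * α * β := by
    rw [hϱ, hϱ, zpow_add_one₀ hα, zpow_add_one₀ hβ]
    ring
  have hr : ϱ n m * (ϱ n m)⁻¹ = 1 := by
    refine mul_inv_cancel₀ ?_
    rw [hϱ]
    exact mul_ne_zero (zpow_ne_zero _ hα) (zpow_ne_zero _ hβ)
  have hs : (-1 : ℝ) ≠ 0 := by norm_num
  have s₁ : (-1 : ℝ)^(n+1+m) = -(-1 : ℝ)^(n+m) := by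
    rw [add_right_comm, zpow_add_one₀ hs, mul_neg_one]
  have s₂ : (-1 : ℝ)^(n+(m+1)) = -(-1 : ℝ)^(n+m) := by
    rw [← add_assoc, zpow_add_one₀ hs, mul_neg_one]
  have s₁₂ : (-1 : ℝ)^(n+1+(m+1)) = (-1 : ℝ)^(n+m) := by
    rw [← add_assoc, zpow_add_one₀ hs, s₁, mul_neg_one, neg_neg]
  have hε : (-1 : ℝ)^(n+m) * (-1 : ℝ)^(n+m) = 1 := by
    rw [← mul_zpow, neg_one_mul, neg_neg, one_zpow]
  have hδ : δ = 4*a*(A*D₀ - B*C) := by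
    rw [hABCD]
    field_simp
  rw [hu n m, hu (n+1) m, hu n (m+1), hu (n+1) (m+1), s₁, s₂, s₁₂, r₁, r₂, r₁₂]
  simp only [mul_inv]
  generalize (-1 : ℝ)^(n+m) = ε at hε ⊢
  generalize ϱ n m = r at hr ⊢
  have key := quad_of_amplitudes (K := 2*a*(p^2-q^2)) (X := (A + ε*B)*r) (X' := (A - ε*B)*r)
    (Y := (ε*C + D₀)*r⁻¹) (Y' := (D₀ - ε*C)*r⁻¹)
    (w := vma n m) (w₁₂ := vma (n+1) (m+1))
    (mul_inv_cancel₀ hα) (mul_inv_cancel₀ hβ) hPα hPα' hQβ hQβ' hα2 hα2' hβ2 hβ2'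
    hX (by linear_combination -hY) hXY' (by linear_combination -hX'Y)
  rw [hδ]
  linear_combination key + 4*a*(p^2-q^2)*(A*D₀ - ε*ε*B*C) * hr - 4*a*(p^2-q^2)*B*C * hε
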